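/- (Exponential convergence to average consensus.) Let L be the Laplacian of a weight-balanced weighted digraph on N vertices with out-degrees dᵢ > 0, d_min = min_i dᵢ, and let Sym(L) = (L+Lᵀ)/2 have eigenvalues 0 = λ₁ ≤ λ₂ ≤ … ≤ λ_N with λ₂ > 0. Let σᵢ ∈ (0,1), σ_max = max_i σᵢ, and 𝒜 = (1/(2λ₂))(1 + √(λ_N σ_max/(2 d_min)))². Let x : ℝ≥0 → ℝᴺ be continuous and x̂ : ℝ≥0 → ℝᴺ be such that: (i) for all t outside a countable set, x is differentiable at t with ẋ(t) = −L x̂(t); and (ii) for all t ≥ 0 and all i, (x̂ᵢ(t) − xᵢ(t))² ≤ (σᵢ/(4dᵢ)) Σⱼ wᵢⱼ(x̂ᵢ(t) − x̂ⱼ(t))². Let x̄ = (1/N)(𝟙ᴺᵀ x(0))𝟙ᴺ. Then for all t ≥ 0, ‖x(t) − x̄‖² ≤ ‖x(0) − x̄‖² · exp( ((σ_max − 1)/(2𝒜)) t ); in particular x(t) → x̄ exponentially fast as t → ∞. -/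

import Mathlib

open Matrix Finset

/-- A function that is continuous on `[0, ∞)` and has negative derivative off a countable set
does not exceed its initial value. -/
lemma le_initial_of_hasDerivAt_neg_off_countable {F : ℝ → ℝ} {s : Set ℝ} (hs : s.Countable)
    (hF : ContinuousOn F (Set.Ici 0))
    (hF' : ∀ t ∈ Set.Ici (0 : ℝ), t ∉ s → ∃ m < 0, HasDerivAt F m t) :
    ∀ t ∈ Set.Ici (0 : ℝ), F t ≤ F 0 := by
  intro b hb
  by_contra! hlt
  obtain ⟨y, ⟨hy0, hyb⟩, hys⟩ : ∃ y ∈ Set.Ioo (F 0) (F b), y ∉ F '' s := by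
    by_contra! hcon
    exact (Cardinal.Real.Ioo_countable_iff.not.2 (not_le.2 hlt))
      ((hs.image F).mono fun y hy => hcon y hy)
  have hb0 : (0 : ℝ) ≤ b := hb
  have hFb : ContinuousOn F (Set.Icc 0 b) := hF.mono Set.Icc_subset_Ici_self
  have hK : IsCompact (Set.Icc 0 b ∩ F ⁻¹' Set.Iic y) :=
    isCompact_Icc.of_isClosed_subset (hFb.preimage_isClosed_of_isClosed isClosed_Icc isClosed_Iic)
      Set.inter_subset_left
  obtain ⟨c, ⟨⟨hc0, hcb⟩, hcy⟩, hmax⟩ := hK.exists_isGreatest ⟨0, ⟨le_rfl, hb0⟩, hy0.le⟩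
  have hcy : F c ≤ y := hcy
  have hcb : c < b := lt_of_le_of_ne hcb (by rintro rfl; linarith)
  have hafter : ∀ t ∈ Set.Ioc c b, y < F t := fun t ht => by
    by_contra! h
    exact absurd (hmax ⟨⟨hc0.trans ht.1.le, ht.2⟩, h⟩) (not_le.2 ht.1)
  have hFc : F c = y := by
    refine hcy.antisymm ?_
    obtain ⟨t, ht, hty⟩ := intermediate_value_Icc hcb.le
      (hF.mono fun t ht => hc0.trans ht.1) ⟨hcy, hyb.le⟩
    rcases ht.1.eq_or_lt with h | h
    · rw [h, hty]
    · exact absurd hty (hafter t ⟨h, ht.2⟩).ne'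
  obtain ⟨m, hm, hd⟩ := hF' c hc0 fun h => hys ⟨c, h, hFc⟩
  have hslope : ∀ᶠ t in nhdsWithin c (Set.Ioi c), slope F c t < 0 :=
    ((hasDerivAt_iff_tendsto_slope.1 hd).mono_left
      (nhdsWithin_mono _ fun t (ht : c < t) => ht.ne')).eventually (gt_mem_nhds hm)
  obtain ⟨t, ht, htI⟩ := (hslope.and (Ioc_mem_nhdsGT hcb)).exists
  rw [slope_def_field] at ht
  have := hafter t htI
  exact absurd ht (not_lt.2 (div_nonneg (by linarith) (by linarith [htI.1])))

/-- A function that is continuous on `[0, ∞)` and has nonpositive derivative off a countable set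
does not exceed its initial value. -/
lemma le_initial_of_hasDerivAt_nonpos_off_countable {F : ℝ → ℝ} {s : Set ℝ} (hs : s.Countable)
    (hF : ContinuousOn F (Set.Ici 0))
    (hF' : ∀ t ∈ Set.Ici (0 : ℝ), t ∉ s → ∃ m ≤ 0, HasDerivAt F m t) :
    ∀ t ∈ Set.Ici (0 : ℝ), F t ≤ F 0 := by
  intro t ht
  have ht0 : (0 : ℝ) ≤ t := ht
  have key : ∀ ε > 0, F t ≤ F 0 + ε * t := fun ε hε => by
    have h := le_initial_of_hasDerivAt_neg_off_countable (F := fun u => F u - ε * u) hs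
      (hF.sub (by fun_prop)) (fun u hu hus => by
        obtain ⟨m, hm, hd⟩ := hF' u hu hus
        exact ⟨m - ε * 1, by linarith, hd.sub ((hasDerivAt_id u).const_mul ε)⟩) t ht
    linarith
  refine le_of_forall_pos_le_add fun δ hδ => (key (δ / (t + 1)) (by positivity)).trans ?_
  have : δ / (t + 1) * t ≤ δ := by
    rw [div_mul_eq_mul_div, div_le_iff₀ (by positivity)]
    nlinarith
  linarith

section Spectral

variable {n : Type*} [Fintype n] {S : Matrix n n ℝ}

/-- Weighted triangle inequality for a positive semidefinite symmetric form. -/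
lemma dotProduct_mulVec_sub_le {q r : ℝ} (hST : Sᵀ = S)
    (hpos : ∀ z : n → ℝ, 0 ≤ z ⬝ᵥ (S *ᵥ z)) (hr : 0 < r) {u e : n → ℝ}
    (hu : u ⬝ᵥ (S *ᵥ u) = q) (he : e ⬝ᵥ (S *ᵥ e) ≤ r ^ 2 * q) :
    (u - e) ⬝ᵥ (S *ᵥ (u - e)) ≤ (1 + r) ^ 2 * q := by
  have hsymm : e ⬝ᵥ (S *ᵥ u) = u ⬝ᵥ (S *ᵥ e) := by
    rw [dotProduct_mulVec, ← mulVec_transpose, hST, dotProduct_comm]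
  have h := hpos (r • u + e)
  simp only [mulVec_add, mulVec_smul, mulVec_sub, add_dotProduct, dotProduct_add, smul_dotProduct,
    dotProduct_smul, sub_dotProduct, dotProduct_sub, smul_eq_mul, hsymm, hu] at h ⊢
  have h' : 0 ≤ r * (r * q + u ⬝ᵥ (S *ᵥ e) * 2 + r * q) := by nlinarith
  have := nonneg_of_mul_nonneg_right h' hr
  nlinarith

lemma dotProduct_symmetrized_mulVec_self (A : Matrix n n ℝ) (z : n → ℝ) :
    z ⬝ᵥ (((1 / 2 : ℝ) • (A + Aᵀ)) *ᵥ z) = z ⬝ᵥ (A *ᵥ z) := by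
  have h : z ⬝ᵥ (Aᵀ *ᵥ z) = z ⬝ᵥ (A *ᵥ z) := by
    rw [mulVec_transpose, dotProduct_comm, dotProduct_mulVec]
  rw [smul_mulVec, add_mulVec, dotProduct_smul, dotProduct_add, h, smul_eq_mul]
  ring

variable [DecidableEq n]

lemma sum_eigenvector_dotProduct_mul (hS : S.IsHermitian) (y z : n → ℝ) :
    ∑ k, (hS.eigenvectorBasis k ⬝ᵥ y) * (hS.eigenvectorBasis k ⬝ᵥ z) = y ⬝ᵥ z := by
  have h := hS.eigenvectorBasis.sum_inner_mul_inner (WithLp.toLp 2 y) (WithLp.toLp 2 z)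
  simp only [EuclideanSpace.inner_eq_star_dotProduct, star_trivial] at h
  rw [dotProduct_comm y z, ← h]
  exact Finset.sum_congr rfl fun k _ => by rw [dotProduct_comm _ z]

lemma eigenvector_dotProduct_mulVec (hS : S.IsHermitian) (k : n) (z : n → ℝ) :
    hS.eigenvectorBasis k ⬝ᵥ (S *ᵥ z) =
      hS.eigenvalues k * (hS.eigenvectorBasis k ⬝ᵥ z) := by
  have hT : Sᵀ = S := by simpa using hS.eq
  rw [dotProduct_mulVec, ← mulVec_transpose, hT, hS.mulVec_eigenvectorBasis, smul_dotProduct,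
    smul_eq_mul]

lemma dotProduct_mulVec_eq_sum_eigenvalues (hS : S.IsHermitian) (y : n → ℝ) :
    y ⬝ᵥ (S *ᵥ y) = ∑ k, hS.eigenvalues k * (hS.eigenvectorBasis k ⬝ᵥ y) ^ 2 := by
  rw [← sum_eigenvector_dotProduct_mul hS]
  exact Finset.sum_congr rfl fun k _ => by rw [eigenvector_dotProduct_mulVec]; ring

lemma dotProduct_mulVec_le_of_eigenvalues_le (hS : S.IsHermitian) {b : ℝ}
    (hb : ∀ k, hS.eigenvalues k ≤ b) (y : n → ℝ) : y ⬝ᵥ (S *ᵥ y) ≤ b * (y ⬝ᵥ y) := by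
  rw [dotProduct_mulVec_eq_sum_eigenvalues hS, ← sum_eigenvector_dotProduct_mul hS y y,
    Finset.mul_sum]
  refine Finset.sum_le_sum fun k _ => ?_
  rw [← sq]
  exact mul_le_mul_of_nonneg_right (hb k) (sq_nonneg _)

/-- If all eigenvalues except possibly the one at `k₀` are at least `a > 0`, then on the orthogonal
complement of a nonzero kernel vector the quadratic form is bounded below by `a`. -/
lemma le_dotProduct_mulVec_of_orthogonal_ker (hS : S.IsHermitian) {a : ℝ} (ha : 0 < a) {k₀ : n}
    (hk : ∀ k ≠ k₀, a ≤ hS.eigenvalues k) {v y : n → ℝ} (hv : S *ᵥ v = 0) (hv0 : v ≠ 0)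
    (hy : y ⬝ᵥ v = 0) : a * (y ⬝ᵥ y) ≤ y ⬝ᵥ (S *ᵥ y) := by
  have hvk : ∀ k ≠ k₀, hS.eigenvectorBasis k ⬝ᵥ v = 0 := fun k hne => by
    have h := eigenvector_dotProduct_mulVec hS k v
    rw [hv, dotProduct_zero] at h
    exact (mul_eq_zero.1 h.symm).resolve_left (ha.trans_le (hk k hne)).ne'
  have hpar : ∀ z : n → ℝ,
      (hS.eigenvectorBasis k₀ ⬝ᵥ z) * (hS.eigenvectorBasis k₀ ⬝ᵥ v) = z ⬝ᵥ v := fun z => by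
    rw [← sum_eigenvector_dotProduct_mul hS z v]
    symm
    exact Finset.sum_eq_single k₀ (fun k _ hne => by rw [hvk k hne, mul_zero])
      fun h => absurd (Finset.mem_univ k₀) h
  have hyk : hS.eigenvectorBasis k₀ ⬝ᵥ y = 0 := by
    refine (mul_eq_zero.1 ((hpar y).trans hy)).resolve_right fun h => hv0 ?_
    exact dotProduct_self_eq_zero.1 (by rw [← hpar v, h, mul_zero])
  rw [dotProduct_mulVec_eq_sum_eigenvalues hS, ← sum_eigenvector_dotProduct_mul hS y y,
    Finset.mul_sum]
  refine Finset.sum_le_sum fun k _ => ?_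
  rcases eq_or_ne k k₀ with rfl | hne
  · simp [hyk]
  · rw [← sq]
    exact mul_le_mul_of_nonneg_right (hk k hne) (sq_nonneg _)

end Spectral

section Laplacian

variable {n : Type*} [Fintype n] [DecidableEq n] {W : Matrix n n ℝ}

lemma laplacian_mulVec_apply (W : Matrix n n ℝ) (z : n → ℝ) (i : n) :
    ((Matrix.diagonal (fun i => ∑ k, W i k) - W) *ᵥ z) i = ∑ j, W i j * (z i - z j) := by
  rw [sub_mulVec, Pi.sub_apply, mulVec_diagonal]
  simp only [mul_sub, Finset.sum_sub_distrib, Finset.sum_mul, mulVec, dotProduct]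

lemma sum_laplacian_mulVec (hbal : ∀ i, ∑ j, W i j = ∑ j, W j i) (z : n → ℝ) :
    ∑ i, ((Matrix.diagonal (fun i => ∑ k, W i k) - W) *ᵥ z) i = 0 := by
  simp only [laplacian_mulVec_apply, mul_sub, Finset.sum_sub_distrib]
  rw [Finset.sum_comm (f := fun i j => W i j * z j), sub_eq_zero]
  simp only [← Finset.sum_mul, hbal]

lemma dotProduct_laplacian_mulVec_self (hbal : ∀ i, ∑ j, W i j = ∑ j, W j i) (z : n → ℝ) :
    z ⬝ᵥ ((Matrix.diagonal (fun i => ∑ k, W i k) - W) *ᵥ z) =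
      1 / 2 * ∑ i, ∑ j, W i j * (z i - z j) ^ 2 := by
  have h : ∑ i, ∑ j, W i j * z i ^ 2 = ∑ i, ∑ j, W i j * z j ^ 2 := by
    rw [Finset.sum_comm (f := fun i j => W i j * z j ^ 2)]
    simp only [← Finset.sum_mul, hbal]
  have h' : ∑ i, ∑ j, W i j * (z i - z j) ^ 2 =
      2 * ∑ i, z i * ∑ j, W i j * (z i - z j) +
        (∑ i, ∑ j, W i j * z j ^ 2 - ∑ i, ∑ j, W i j * z i ^ 2) := by
    simp only [Finset.mul_sum, ← Finset.sum_sub_distrib, ← Finset.sum_add_distrib]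
    exact Finset.sum_congr rfl fun i _ => Finset.sum_congr rfl fun j _ => by ring
  simp only [dotProduct, laplacian_mulVec_apply]
  rw [h', h]
  ring

lemma symmetrized_laplacian_mulVec_one (hbal : ∀ i, ∑ j, W i j = ∑ j, W j i) :
    ((1 / 2 : ℝ) • ((Matrix.diagonal (fun i => ∑ k, W i k) - W) +
      (Matrix.diagonal (fun i => ∑ k, W i k) - W)ᵀ)) *ᵥ (1 : n → ℝ) = 0 := by
  have h1 : (Matrix.diagonal (fun i => ∑ k, W i k) - W) *ᵥ (1 : n → ℝ) = 0 := by
    ext i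
    simp [laplacian_mulVec_apply]
  have h2 : (Matrix.diagonal (fun i => ∑ k, W i k) - W)ᵀ *ᵥ (1 : n → ℝ) = 0 := by
    ext i
    rw [transpose_sub, diagonal_transpose, sub_mulVec, Pi.sub_apply, mulVec_diagonal]
    simp [mulVec, dotProduct, hbal]
  rw [smul_mulVec, add_mulVec, h1, h2, add_zero, smul_zero]

/-- Under the trigger condition, the error contributes at most a fraction of the dissipation. -/
lemma dotProduct_laplacian_mulVec_le_of_trigger (hW : ∀ i j, 0 ≤ W i j)
    (hbal : ∀ i, ∑ j, W i j = ∑ j, W j i) (hd : ∀ i, 0 < ∑ j, W i j) {σ : n → ℝ} {σmax : ℝ}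
    (hσ : ∀ i, σ i ≤ σmax) {e u : n → ℝ}
    (he : ∀ i, e i ^ 2 ≤ σ i / (4 * ∑ j, W i j) * ∑ j, W i j * (u i - u j) ^ 2) :
    e ⬝ᵥ ((Matrix.diagonal (fun i => ∑ k, W i k) - W) *ᵥ u) ≤
      (σmax + 1) / 2 * (u ⬝ᵥ ((Matrix.diagonal (fun i => ∑ k, W i k) - W) *ᵥ u)) := by
  rw [dotProduct_laplacian_mulVec_self hbal, ← mul_assoc, Finset.mul_sum]
  simp only [dotProduct, laplacian_mulVec_apply]
  refine Finset.sum_le_sum fun i _ => ?_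
  have hq : 0 ≤ ∑ j, W i j * (u i - u j) ^ 2 :=
    Finset.sum_nonneg fun j _ => mul_nonneg (hW i j) (sq_nonneg _)
  have h1 : e i * ∑ j, W i j * (u i - u j) ≤
      (∑ j, W i j) * e i ^ 2 + 1 / 4 * ∑ j, W i j * (u i - u j) ^ 2 := by
    rw [Finset.mul_sum, Finset.mul_sum, Finset.sum_mul, ← Finset.sum_add_distrib]
    refine Finset.sum_le_sum fun j _ => ?_
    nlinarith [mul_nonneg (hW i j) (sq_nonneg (e i - (u i - u j) / 2))]
  have h2 : (∑ j, W i j) * e i ^ 2 ≤ σ i / 4 * ∑ j, W i j * (u i - u j) ^ 2 := by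
    refine (mul_le_mul_of_nonneg_left (he i) (hd i).le).trans_eq ?_
    have := (hd i).ne'
    field_simp
  nlinarith [mul_le_mul_of_nonneg_right (hσ i) hq]

/-- Under the trigger condition, the squared error is bounded by the dissipation. -/
lemma dotProduct_self_le_of_trigger (hW : ∀ i j, 0 ≤ W i j)
    (hbal : ∀ i, ∑ j, W i j = ∑ j, W j i) {σ : n → ℝ} {σmax dmin : ℝ} (hdmin : 0 < dmin)
    (hd : ∀ i, dmin ≤ ∑ j, W i j) (hσ0 : 0 ≤ σmax) (hσ : ∀ i, σ i ≤ σmax) {e u : n → ℝ}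
    (he : ∀ i, e i ^ 2 ≤ σ i / (4 * ∑ j, W i j) * ∑ j, W i j * (u i - u j) ^ 2) :
    e ⬝ᵥ e ≤ σmax / (2 * dmin) *
      (u ⬝ᵥ ((Matrix.diagonal (fun i => ∑ k, W i k) - W) *ᵥ u)) := by
  rw [dotProduct_laplacian_mulVec_self hbal, ← mul_assoc, Finset.mul_sum]
  refine Finset.sum_le_sum fun i _ => ?_
  have hq : 0 ≤ ∑ j, W i j * (u i - u j) ^ 2 :=
    Finset.sum_nonneg fun j _ => mul_nonneg (hW i j) (sq_nonneg _)
  rw [← sq]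
  refine (he i).trans (mul_le_mul_of_nonneg_right ?_ hq)
  calc σ i / (4 * ∑ j, W i j) ≤ σmax / (4 * dmin) :=
        div_le_div₀ hσ0 (hσ i) (by positivity) (by linarith [hd i])
    _ = σmax / (2 * dmin) * (1 / 2) := by field_simp; norm_num

end Laplacian

/-- exponential convergence to average consensus, Theorem 1:
for a weight-balanced digraph with Laplacian `L`, out-degrees `dᵢ > 0`, `d_min = minᵢ dᵢ`,
eigenvalues `0 = λ₁ ≤ λ₂ ≤ … ≤ λ_N` of `Sym(L) = (L + Lᵀ)/2` with `λ₂ > 0`,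
`σᵢ ∈ (0,1)`, `σ_max = maxᵢ σᵢ`, `𝒜 = (1/(2λ₂))(1 + √(λ_N σ_max/(2 d_min)))²`: if
`x : ℝ≥0 → ℝᴺ` is continuous, `ẋ(t) = -L x̂(t)` for all `t` outside a countable set, and
the trigger condition `(x̂ᵢ(t) - xᵢ(t))² ≤ (σᵢ/(4dᵢ)) ∑ⱼ wᵢⱼ(x̂ᵢ(t) - x̂ⱼ(t))²` holds for
all `t ≥ 0` and all `i`, then with `x̄ = (1/N)(𝟙ᵀ x(0))𝟙`,
`‖x(t) - x̄‖² ≤ ‖x(0) - x̄‖² exp(((σ_max - 1)/(2𝒜)) t)` for all `t ≥ 0`. -/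
theorem exponential_convergence_to_average_consensus
    (N : ℕ) (hN : 1 < N) (W : Matrix (Fin N) (Fin N) ℝ)
    (hWnn : ∀ i j, 0 ≤ W i j) (hWdiag : ∀ i, W i i = 0)
    (hbal : ∀ i, ∑ j, W i j = ∑ j, W j i)
    (hd : ∀ i, 0 < ∑ j, W i j)
    (L : Matrix (Fin N) (Fin N) ℝ)
    (hL : L = Matrix.diagonal (fun i => ∑ k, W i k) - W)
    (S : Matrix (Fin N) (Fin N) ℝ) (hS : S = (1/2 : ℝ) • (L + Lᵀ))
    (hherm : S.IsHermitian)
    (μ : Fin N → ℝ) (hmono : Monotone μ) (π : Equiv.Perm (Fin N))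
    (hμ : ∀ k, μ k = hherm.eigenvalues (π k))
    (hμ0 : μ ⟨0, by omega⟩ = 0)
    (hlam2 : 0 < μ ⟨1, hN⟩)
    (σ : Fin N → ℝ) (hσ : ∀ i, σ i ∈ Set.Ioo (0 : ℝ) 1)
    (dmin σmax 𝒜 : ℝ)
    (hdmin : dmin = Finset.univ.inf' ⟨⟨0, by omega⟩, Finset.mem_univ _⟩
      (fun i => ∑ j, W i j))
    (hσmax : σmax = Finset.univ.sup' ⟨⟨0, by omega⟩, Finset.mem_univ _⟩ σ)
    (hA : 𝒜 = 1 / (2 * μ ⟨1, hN⟩) *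
      (1 + Real.sqrt (μ ⟨N - 1, by omega⟩ * σmax / (2 * dmin)))^2)
    (x xhat : ℝ → Fin N → ℝ)
    (hcont : ∀ i, ContinuousOn (fun t => x t i) (Set.Ici (0 : ℝ)))
    (s : Set ℝ) (hs : s.Countable)
    (hderiv : ∀ t ∈ Set.Ici (0 : ℝ), t ∉ s →
      ∀ i, HasDerivAt (fun u => x u i) (-(L.mulVec (xhat t)) i) t)
    (htrig : ∀ t ∈ Set.Ici (0 : ℝ), ∀ i, (xhat t i - x t i)^2 ≤
      σ i / (4 * ∑ j, W i j) * ∑ j, W i j * (xhat t i - xhat t j)^2) :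
    ∀ t ∈ Set.Ici (0 : ℝ),
      ∑ i, (x t i - (1 / (N : ℝ)) * ∑ j, x 0 j)^2
        ≤ (∑ i, (x 0 i - (1 / (N : ℝ)) * ∑ j, x 0 j)^2)
          * Real.exp ((σmax - 1) / (2 * 𝒜) * t) := by
  have hdmin_le : ∀ i, dmin ≤ ∑ j, W i j := fun i => by
    rw [hdmin]
    exact Finset.inf'_le (fun i => ∑ j, W i j) (Finset.mem_univ i)
  have hdmin_pos : 0 < dmin := by
    rw [hdmin]
    exact (Finset.lt_inf'_iff _).2 fun i _ => hd i
  have hσ_le : ∀ i, σ i ≤ σmax := fun i => by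
    rw [hσmax]
    exact Finset.le_sup' σ (Finset.mem_univ i)
  have hσmax_pos : 0 < σmax := (hσ ⟨0, by omega⟩).1.trans_le (hσ_le _)
  have hσmax_lt : σmax < 1 := by
    rw [hσmax]
    exact (Finset.sup'_lt_iff _).2 fun i _ => (hσ i).2
  have hlamN : 0 < μ ⟨N - 1, by omega⟩ := hlam2.trans_le (hmono (Fin.mk_le_mk.2 (by omega)))
  have heig : ∀ k, hherm.eigenvalues k = μ (π.symm k) := fun k => by
    rw [hμ, Equiv.apply_symm_apply]
  have heig_le : ∀ k, hherm.eigenvalues k ≤ μ ⟨N - 1, by omega⟩ := fun k => by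
    rw [heig]
    exact hmono (Fin.le_def.2 (Nat.le_sub_one_of_lt (π.symm k).2))
  have heig_ge : ∀ k ≠ π ⟨0, by omega⟩, μ ⟨1, hN⟩ ≤ hherm.eigenvalues k := fun k hk => by
    rw [heig]
    refine hmono (Fin.le_def.2 (Nat.one_le_iff_ne_zero.2 fun h => hk ?_))
    rw [← Equiv.symm_apply_eq]
    exact Fin.ext h
  have hST : Sᵀ = S := by simpa using hherm.eq
  have hSL : ∀ z : Fin N → ℝ, z ⬝ᵥ (S *ᵥ z) = z ⬝ᵥ (L *ᵥ z) := fun z => by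
    rw [hS, dotProduct_symmetrized_mulVec_self]
  have hpos : ∀ z : Fin N → ℝ, 0 ≤ z ⬝ᵥ (S *ᵥ z) := fun z => by
    rw [hSL, hL, dotProduct_laplacian_mulVec_self hbal]
    exact mul_nonneg (by norm_num) (Finset.sum_nonneg fun i _ => Finset.sum_nonneg fun j _ =>
      mul_nonneg (hWnn i j) (sq_nonneg _))
  have hS1 : S *ᵥ (1 : Fin N → ℝ) = 0 := by
    rw [hS, hL, symmetrized_laplacian_mulVec_one hbal]
  have hone : (1 : Fin N → ℝ) ≠ 0 := fun h => one_ne_zero (congrFun h ⟨0, by omega⟩)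
  have hLsum : ∀ z : Fin N → ℝ, ∑ i, (L *ᵥ z) i = 0 := fun z => by
    rw [hL, sum_laplacian_mulVec hbal]
  have hsum_deriv : ∀ t ∈ Set.Ici (0 : ℝ), t ∉ s →
      HasDerivAt (fun u => ∑ i, x u i) 0 t := fun t ht hts => by
    have h := HasDerivAt.fun_sum (u := Finset.univ) fun i _ => hderiv t ht hts i
    rwa [Finset.sum_neg_distrib, hLsum, neg_zero] at h
  have hsum_cont : ContinuousOn (fun u => ∑ i, x u i) (Set.Ici 0) :=
    continuousOn_finsetSum _ fun i _ => hcont i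
  have hmean : ∀ t ∈ Set.Ici (0 : ℝ), ∑ i, x t i = ∑ i, x 0 i := fun t ht =>
    le_antisymm
      (le_initial_of_hasDerivAt_nonpos_off_countable hs hsum_cont
        (fun u hu hus => ⟨0, le_rfl, hsum_deriv u hu hus⟩) t ht)
      (neg_le_neg_iff.1 (le_initial_of_hasDerivAt_nonpos_off_countable hs hsum_cont.neg
        (fun u hu hus => ⟨-0, by simp, (hsum_deriv u hu hus).neg⟩) t ht))
  set m : ℝ := (1 / (N : ℝ)) * ∑ j, x 0 j with hm
  set r : ℝ := Real.sqrt (μ ⟨N - 1, by omega⟩ * σmax / (2 * dmin)) with hr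
  have hr_pos : 0 < r := Real.sqrt_pos.2 (by positivity)
  have hr_sq : r ^ 2 = μ ⟨N - 1, by omega⟩ * σmax / (2 * dmin) := Real.sq_sqrt (by positivity)
  have hA_pos : 0 < 𝒜 := by rw [hA]; positivity
  have hV_le : ∀ t ∈ Set.Ici (0 : ℝ),
      ∑ i, (x t i - m) ^ 2 ≤ 2 * 𝒜 * (xhat t ⬝ᵥ (L *ᵥ xhat t)) := fun t ht => by
    have he := dotProduct_self_le_of_trigger (e := xhat t - x t) hWnn hbal hdmin_pos hdmin_le
      hσmax_pos.le hσ_le (htrig t ht)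
    rw [← hL] at he
    have heS := (dotProduct_mulVec_le_of_eigenvalues_le hherm heig_le (xhat t - x t)).trans
      (mul_le_mul_of_nonneg_left he hlamN.le)
    have htri := dotProduct_mulVec_sub_le hST hpos hr_pos (hSL (xhat t)) (e := xhat t - x t)
      (heS.trans_eq (by rw [hr_sq]; ring))
    rw [sub_sub_cancel] at htri
    have hN0 : (N : ℝ) ≠ 0 := by positivity
    have horth : (x t - m • (1 : Fin N → ℝ)) ⬝ᵥ 1 = 0 := by
      simp only [dotProduct_one, Pi.sub_apply, Finset.sum_sub_distrib, hmean t ht]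
      simp [hm, hN0]
    have hgap := le_dotProduct_mulVec_of_orthogonal_ker hherm hlam2 heig_ge hS1 hone horth
    have hshift : (x t - m • (1 : Fin N → ℝ)) ⬝ᵥ (S *ᵥ (x t - m • (1 : Fin N → ℝ))) =
        x t ⬝ᵥ (S *ᵥ x t) := by
      have h1 : (1 : Fin N → ℝ) ⬝ᵥ (S *ᵥ x t) = 0 := by
        rw [dotProduct_mulVec, ← mulVec_transpose, hST, hS1, zero_dotProduct]
      rw [mulVec_sub, mulVec_smul, hS1, smul_zero, sub_zero, sub_dotProduct, smul_dotProduct, h1,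
        smul_zero, sub_zero]
    have hself : (x t - m • (1 : Fin N → ℝ)) ⬝ᵥ (x t - m • (1 : Fin N → ℝ)) =
        ∑ i, (x t i - m) ^ 2 := by
      simp [dotProduct, sq]
    rw [hshift, hself] at hgap
    have h := hgap.trans htri
    rw [← le_div_iff₀' hlam2] at h
    refine h.trans_eq ?_
    rw [hA]
    field_simp
  have hV_deriv : ∀ t ∈ Set.Ici (0 : ℝ), t ∉ s →
      HasDerivAt (fun u => ∑ i, (x u i - m) ^ 2) (-2 * (x t ⬝ᵥ (L *ᵥ xhat t))) t :=
    fun t ht hts => by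
      have h := HasDerivAt.fun_sum (u := Finset.univ) fun i _ =>
        ((hderiv t ht hts i).sub_const m).fun_pow 2
      refine h.congr_deriv ?_
      have h0 : ∑ i, 2 * m * (L *ᵥ xhat t) i = 0 := by rw [← Finset.mul_sum, hLsum, mul_zero]
      symm
      rw [← add_zero (-2 * _), ← h0, dotProduct, Finset.mul_sum, ← Finset.sum_add_distrib]
      exact Finset.sum_congr rfl fun i _ => by push_cast; ring
  have hdiss : ∀ t ∈ Set.Ici (0 : ℝ),
      -2 * (x t ⬝ᵥ (L *ᵥ xhat t)) ≤ (σmax - 1) / (2 * 𝒜) * ∑ i, (x t i - m) ^ 2 :=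
    fun t ht => by
      have he := dotProduct_laplacian_mulVec_le_of_trigger (e := xhat t - x t) hWnn hbal hd hσ_le
        (htrig t ht)
      rw [← hL, sub_dotProduct] at he
      have h := mul_le_mul_of_nonpos_left (hV_le t ht)
        (div_nonpos_of_nonpos_of_nonneg (by linarith : σmax - 1 ≤ 0)
          (by positivity : 0 ≤ 2 * 𝒜))
      rw [← mul_assoc, div_mul_cancel₀ _ (by positivity)] at h
      linarith
  intro t ht
  set c : ℝ := (σmax - 1) / (2 * 𝒜)
  have hG := le_initial_of_hasDerivAt_nonpos_off_countable
    (F := fun u => (∑ i, (x u i - m) ^ 2) * Real.exp (-(c * u))) hs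
    ((continuousOn_finsetSum _ fun i _ => ((hcont i).sub continuousOn_const).pow 2).mul
      (by fun_prop))
    (fun u hu hus => by
      refine ⟨_, ?_, (hV_deriv u hu hus).mul (((hasDerivAt_id u).const_mul c).neg.exp)⟩
      have h := mul_nonneg (sub_nonneg.2 (hdiss u hu)) (Real.exp_pos (-(c * u))).le
      simp only [id, Pi.neg_apply]
      nlinarith) t ht
  simp only [mul_zero, neg_zero, Real.exp_zero, mul_one] at hG
  rwa [Real.exp_neg, ← div_eq_mul_inv, div_le_iff₀ (Real.exp_pos _)] at hG
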